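/- Let ℓ : ℝ^d → ℝ be differentiable, λ-strongly convex with λ > 0, μ-smooth (∇ℓ is μ-Lipschitz), with global minimizer w*. On a probability space with a filtration (ℱ_t)_{t≥1}, let (w_t)_{t≥1} be iterates with w_1 deterministic and w_{t+1} = w_t − η_t ĝ_t, where η_t = 1/(λt), w_t is ℱ_t-measurable, and ĝ_t satisfies E[ĝ_t | ℱ_t] = ∇ℓ(w_t) and E[‖ĝ_t‖² | ℱ_t] ≤ G_t² almost surely for deterministic constants G_t. Then for every T ≥ 1, E[ℓ(w_{T+1})] − ℓ(w*) ≤ (2μ/(λ²T²)) Σ_{t=1}^{T} G_t². -/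

import Mathlib

open MeasureTheory
open scoped RealInnerProductSpace

section StronglyConvex

variable {E : Type*} [NormedAddCommGroup E] [InnerProductSpace ℝ E] [CompleteSpace E]
  {f : E → ℝ} {lam mu : ℝ} {a : E}

lemma gradient_eq_zero_of_forall_le (ha : ∀ x, f a ≤ f x) : gradient f a = 0 := by
  have h : IsLocalMin f a := Filter.Eventually.of_forall ha
  simp [gradient, h.fderiv_eq_zero]

lemma mul_sq_norm_sub_le_inner_gradient
    (hsc : ∀ u v : E, f u + ⟪gradient f u, v - u⟫ + lam / 2 * ‖v - u‖ ^ 2 ≤ f v)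
    (ha : ∀ x, f a ≤ f x) (x : E) : lam * ‖x - a‖ ^ 2 ≤ ⟪x - a, gradient f x⟫ := by
  have h₁ := hsc x a
  have h₂ := hsc a x
  rw [gradient_eq_zero_of_forall_le ha, inner_zero_left] at h₂
  rw [← neg_sub x a, inner_neg_right, norm_neg, real_inner_comm] at h₁
  linarith

lemma sub_le_mul_sq_norm_sub (hlam : 0 ≤ lam)
    (hsc : ∀ u v : E, f u + ⟪gradient f u, v - u⟫ + lam / 2 * ‖v - u‖ ^ 2 ≤ f v)
    (hsmooth : ∀ u v : E, ‖gradient f u - gradient f v‖ ≤ mu * ‖u - v‖)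
    (ha : ∀ x, f a ≤ f x) (x : E) : f x - f a ≤ mu * ‖x - a‖ ^ 2 := by
  have h₁ := hsc x a
  have h₂ := hsmooth x a
  rw [gradient_eq_zero_of_forall_le ha, sub_zero] at h₂
  rw [← neg_sub x a, inner_neg_right, norm_neg] at h₁
  have h₃ := real_inner_le_norm (gradient f x) (x - a)
  have h₄ := mul_le_mul_of_nonneg_right h₂ (norm_nonneg (x - a))
  have h₅ : 0 ≤ lam / 2 * ‖x - a‖ ^ 2 := by positivity
  linarith

end StronglyConvex

section SecondMoment

variable {Ω E : Type*} {m mΩ : MeasurableSpace Ω} {P : Measure Ω}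
  [NormedAddCommGroup E] [InnerProductSpace ℝ E] {X Y : Ω → E}

lemma integrable_inner_of_memLp_two (hX : MemLp X 2 P) (hY : MemLp Y 2 P) :
    Integrable (fun ω => ⟪X ω, Y ω⟫) P :=
  (hX.norm.integrable_mul hY.norm).mono (hX.1.inner hY.1)
    (Filter.Eventually.of_forall fun ω => by simpa using norm_inner_le_norm (𝕜 := ℝ) (X ω) (Y ω))

lemma integral_inner_condExp_right [CompleteSpace E] [IsFiniteMeasure P] (hm : m ≤ mΩ)
    (hXm : StronglyMeasurable[m] X) (hX : MemLp X 2 P) (hY : MemLp Y 2 P) :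
    Integrable (fun ω => ⟪X ω, (P[Y | m]) ω⟫) P ∧
      ∫ ω, ⟪X ω, (P[Y | m]) ω⟫ ∂P = ∫ ω, ⟪X ω, Y ω⟫ ∂P := by
  have h : P[fun ω => ⟪X ω, Y ω⟫ | m] =ᵐ[P] fun ω => ⟪X ω, (P[Y | m]) ω⟫ :=
    condExp_bilin_of_stronglyMeasurable_left (innerSL ℝ) hXm
      (integrable_inner_of_memLp_two hX hY) (hY.integrable one_le_two)
  exact ⟨integrable_condExp.congr h, by rw [← integral_congr_ae h, integral_condExp hm]⟩

lemma integral_sq_norm_sub_smul (hX : MemLp X 2 P) (hY : MemLp Y 2 P) (c : ℝ) :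
    ∫ ω, ‖X ω - c • Y ω‖ ^ 2 ∂P =
      ∫ ω, ‖X ω‖ ^ 2 ∂P - 2 * c * ∫ ω, ⟪X ω, Y ω⟫ ∂P + c ^ 2 * ∫ ω, ‖Y ω‖ ^ 2 ∂P := by
  have hX2 := hX.integrable_norm_pow two_ne_zero
  have hY2 := hY.integrable_norm_pow two_ne_zero
  have hXY := integrable_inner_of_memLp_two hX hY
  rw [← integral_const_mul, ← integral_const_mul, ← integral_sub hX2 (hXY.const_mul _),
    ← integral_add (by exact hX2.sub (hXY.const_mul _)) (hY2.const_mul _)]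
  refine integral_congr_ae (Filter.Eventually.of_forall fun ω => ?_)
  simp only [norm_sub_sq_real, inner_smul_right, norm_smul, mul_pow, Real.norm_eq_abs, sq_abs]
  ring

/-- One gradient step contracts the mean squared distance to the minimizer. -/
lemma integral_sq_norm_sub_smul_le [CompleteSpace E] [IsProbabilityMeasure P] (hm : m ≤ mΩ)
    {lam c B : ℝ} (hc : 0 ≤ c) (hXm : StronglyMeasurable[m] X) (hX : MemLp X 2 P)
    (hY : MemLp Y 2 P) (hmono : ∀ᵐ ω ∂P, lam * ‖X ω‖ ^ 2 ≤ ⟪X ω, (P[Y | m]) ω⟫)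
    (hB : ∀ᵐ ω ∂P, (P[fun ω' => ‖Y ω'‖ ^ 2 | m]) ω ≤ B) :
    ∫ ω, ‖X ω - c • Y ω‖ ^ 2 ∂P ≤ (1 - 2 * c * lam) * ∫ ω, ‖X ω‖ ^ 2 ∂P + c ^ 2 * B := by
  obtain ⟨hint, heq⟩ := integral_inner_condExp_right hm hXm hX hY
  have h₁ : lam * ∫ ω, ‖X ω‖ ^ 2 ∂P ≤ ∫ ω, ⟪X ω, Y ω⟫ ∂P := by
    rw [← heq, ← integral_const_mul]
    exact integral_mono_ae ((hX.integrable_norm_pow two_ne_zero).const_mul _) hint hmono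
  have h₂ : ∫ ω, ‖Y ω‖ ^ 2 ∂P ≤ B := by
    rw [← integral_condExp hm]
    simpa using integral_mono_ae integrable_condExp (integrable_const B) hB
  rw [integral_sq_norm_sub_smul hX hY]
  have h₃ := mul_le_mul_of_nonneg_left h₁ hc
  have h₄ := mul_le_mul_of_nonneg_left h₂ (sq_nonneg c)
  linarith

end SecondMoment

/-- Solution of the recursion satisfied by the mean squared error of SGD with step `1 / (λ t)`. -/
lemma sq_mul_le_sum_of_step_le {a b : ℕ → ℝ} {lam : ℝ} (hlam : lam ≠ 0) (ha : ∀ t, 0 ≤ a t)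
    (hstep : ∀ t, 1 ≤ t →
      a (t + 1) ≤ (1 - 2 * (1 / (lam * t)) * lam) * a t + (1 / (lam * t)) ^ 2 * b t) (T : ℕ) :
    lam ^ 2 * (T : ℝ) ^ 2 * a (T + 1) ≤ ∑ t ∈ Finset.Icc 1 T, b t := by
  induction T with
  | zero => simp
  | succ n ih =>
    rw [Finset.sum_Icc_succ_top (by omega)]
    have h := mul_le_mul_of_nonneg_left (hstep (n + 1) (by omega))
      (by positivity : 0 ≤ lam ^ 2 * ((n + 1 : ℕ) : ℝ) ^ 2)
    have hn : ((n + 1 : ℕ) : ℝ) ≠ 0 := by positivity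
    have e : lam ^ 2 * ((n + 1 : ℕ) : ℝ) ^ 2 *
        ((1 - 2 * (1 / (lam * (n + 1 : ℕ))) * lam) * a (n + 1) +
          (1 / (lam * (n + 1 : ℕ))) ^ 2 * b (n + 1)) =
        lam ^ 2 * (((n + 1 : ℕ) : ℝ) ^ 2 - 2 * (n + 1 : ℕ)) * a (n + 1) + b (n + 1) := by
      field_simp
    rw [e] at h
    have h' : 0 ≤ lam ^ 2 * a (n + 1) := mul_nonneg (sq_nonneg _) (ha _)
    push_cast at h ⊢
    linarith

/-- Convergence of SGD with learning rate `η_t = 1/(λt)` on a `λ`-strongly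
convex and `μ`-smooth function, with conditionally unbiased stochastic
gradients whose conditional second moments are bounded by `G_t²`:
`E[ℓ(w_{T+1})] - ℓ(w*) ≤ (2μ/(λ²T²)) Σ_{t=1}^T G_t²` for every `T ≥ 1`. -/
theorem sgd_suboptimality_bound
    {Ω : Type*} {mΩ : MeasurableSpace Ω} (P : Measure Ω) [IsProbabilityMeasure P]
    (d : ℕ) (ℓ : EuclideanSpace ℝ (Fin d) → ℝ)
    (lam mu : ℝ) (hlam : 0 < lam) (hmu : 0 < mu)
    (hdiff : Differentiable ℝ ℓ)
    (hsc : ∀ u v : EuclideanSpace ℝ (Fin d),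
      ℓ u + ⟪gradient ℓ u, v - u⟫ + lam / 2 * ‖v - u‖ ^ 2 ≤ ℓ v)
    (hsmooth : ∀ u v : EuclideanSpace ℝ (Fin d),
      ‖gradient ℓ u - gradient ℓ v‖ ≤ mu * ‖u - v‖)
    (wstar : EuclideanSpace ℝ (Fin d)) (hmin : ∀ w, ℓ wstar ≤ ℓ w)
    (ℱ : Filtration ℕ mΩ)
    (w ghat : ℕ → Ω → EuclideanSpace ℝ (Fin d))
    (w₁ : EuclideanSpace ℝ (Fin d)) (hw₁ : ∀ ω, w 1 ω = w₁)
    (hupdate : ∀ t, 1 ≤ t → ∀ ω,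
      w (t + 1) ω = w t ω - (1 / (lam * t)) • ghat t ω)
    (hadapted : ∀ t, 1 ≤ t → StronglyMeasurable[ℱ t] (w t))
    (hghat_meas : ∀ t, Measurable (ghat t))
    (hghat_int : ∀ t, Integrable (ghat t) P)
    (hghat_sq_int : ∀ t, Integrable (fun ω => ‖ghat t ω‖ ^ 2) P)
    (hunbiased : ∀ t, 1 ≤ t →
      P[ghat t | ℱ t] =ᵐ[P] fun ω => gradient ℓ (w t ω))
    (G : ℕ → ℝ)
    (hG : ∀ t, 1 ≤ t →
      ∀ᵐ ω ∂P, (P[fun ω' => ‖ghat t ω'‖ ^ 2 | ℱ t]) ω ≤ (G t) ^ 2) :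
    ∀ T, 1 ≤ T →
      (∫ ω, ℓ (w (T + 1) ω) ∂P) - ℓ wstar ≤
        (2 * mu / (lam ^ 2 * (T : ℝ) ^ 2)) * ∑ t ∈ Finset.Icc 1 T, (G t) ^ 2 := by
  intro T hT
  have hg : ∀ t, MemLp (ghat t) 2 P := fun t =>
    (memLp_two_iff_integrable_sq_norm (hghat_meas t).aestronglyMeasurable).2 (hghat_sq_int t)
  have hX : ∀ t, 1 ≤ t → MemLp (fun ω => w t ω - wstar) 2 P := by
    intro t ht
    induction t, ht using Nat.le_induction with
    | base => simpa only [hw₁] using memLp_const (w₁ - wstar)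
    | succ t ht ih =>
      simp only [hupdate t ht, sub_right_comm _ _ wstar]
      exact ih.sub ((hg t).const_smul (1 / (lam * t)))
  have hstep : ∀ t, 1 ≤ t → ∫ ω, ‖w (t + 1) ω - wstar‖ ^ 2 ∂P ≤
      (1 - 2 * (1 / (lam * t)) * lam) * ∫ ω, ‖w t ω - wstar‖ ^ 2 ∂P +
        (1 / (lam * t)) ^ 2 * G t ^ 2 := by
    intro t ht
    simp only [hupdate t ht, sub_right_comm _ _ wstar]
    refine integral_sq_norm_sub_smul_le (ℱ.le t) (by positivity)
      ((hadapted t ht).sub stronglyMeasurable_const) (hX t ht) (hg t) ?_ (hG t ht)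
    filter_upwards [hunbiased t ht] with ω hω
    rw [hω]
    exact mul_sq_norm_sub_le_inner_gradient hsc hmin (w t ω)
  have hsum := sq_mul_le_sum_of_step_le (a := fun t => ∫ ω, ‖w t ω - wstar‖ ^ 2 ∂P) hlam.ne'
    (fun t => integral_nonneg fun ω => by positivity) hstep T
  have hsub := sub_le_mul_sq_norm_sub hlam.le hsc hsmooth hmin
  have hbound := ((hX (T + 1) (by omega)).integrable_norm_pow two_ne_zero).const_mul mu
  have hgap : Integrable (fun ω => ℓ (w (T + 1) ω) - ℓ wstar) P := by
    refine hbound.mono' ?_ (Filter.Eventually.of_forall fun ω => ?_)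
    · exact ((hdiff.continuous.comp_stronglyMeasurable
        ((hadapted (T + 1) (by omega)).mono (ℱ.le _))).sub
          stronglyMeasurable_const).aestronglyMeasurable
    · rw [Real.norm_of_nonneg (sub_nonneg.2 (hmin _))]
      exact hsub _
  have hℓ : Integrable (fun ω => ℓ (w (T + 1) ω)) P :=
    (hgap.add (integrable_const (ℓ wstar))).congr
      (Filter.Eventually.of_forall fun ω => sub_add_cancel _ _)
  have hS : 0 ≤ ∑ t ∈ Finset.Icc 1 T, G t ^ 2 := Finset.sum_nonneg fun t _ => sq_nonneg _
  have hT₀ : (0 : ℝ) < T := by exact_mod_cast hT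
  calc (∫ ω, ℓ (w (T + 1) ω) ∂P) - ℓ wstar
      = ∫ ω, (ℓ (w (T + 1) ω) - ℓ wstar) ∂P := by
        rw [integral_sub hℓ (integrable_const _)]; simp
    _ ≤ mu * ∫ ω, ‖w (T + 1) ω - wstar‖ ^ 2 ∂P := by
        rw [← integral_const_mul]
        exact integral_mono hgap hbound fun ω => hsub _
    _ ≤ mu * ((∑ t ∈ Finset.Icc 1 T, G t ^ 2) / (lam ^ 2 * (T : ℝ) ^ 2)) := by
        gcongr
        rw [le_div_iff₀' (by positivity)]
        exact hsum
    _ ≤ 2 * mu * ((∑ t ∈ Finset.Icc 1 T, G t ^ 2) / (lam ^ 2 * (T : ℝ) ^ 2)) := by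
        gcongr
        linarith
    _ = (2 * mu / (lam ^ 2 * (T : ℝ) ^ 2)) * ∑ t ∈ Finset.Icc 1 T, (G t) ^ 2 := by ring
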